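/- arXiv:2302.06094 — 4 statements merged into one kernel-verified Lean document; each statement's English description precedes it below -/
import Mathlib

section
/- Let m and n be integers with m > n ≥ 2, and let π : GL(2, ℤ/2^mℤ) → GL(2, ℤ/2^nℤ) be the natural reduction homomorphism. Then the kernel of π equals the subgroup of GL(2, ℤ/2^mℤ) generated by the four matrices [[1+2^n, 0],[0, 1]], [[1, 0],[0, 1+2^n]], [[1, 2^n],[0, 1]], and [[1, 0],[2^n, 1]]. -/
open Matrix

theorem one_add_two_pow_pow_two_pow (n : ℕ) (hn : 2 ≤ n) (j : ℕ) :
    ∃ s : ℤ, (1 + 2 ^ n : ℤ) ^ 2 ^ j = 1 + 2 ^ (n + j) * (1 + 2 * s) := by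
  induction j with
  | zero => exact ⟨0, by simp⟩
  | succ j ih =>
    obtain ⟨s, hs⟩ := ih
    obtain ⟨r, rfl⟩ := Nat.exists_eq_add_of_le hn
    refine ⟨s + 2 ^ (r + j) * (1 + 2 * s) ^ 2, ?_⟩
    rw [pow_succ, pow_mul, hs]
    ring

theorem exists_one_add_two_pow_pow_eq_add (n : ℕ) (hn : 2 ≤ n) (a : ℤ) (j : ℕ) :
    ∃ (k : ℕ) (t : ℤ), (1 + 2 ^ n : ℤ) ^ k = 1 + 2 ^ n * a + 2 ^ (n + j) * t := by
  induction j with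
  | zero => exact ⟨0, -a, by simp⟩
  | succ j ih =>
    obtain ⟨k, t, h⟩ := ih
    obtain ⟨t, rfl | rfl⟩ := Int.even_or_odd' t
    · exact ⟨k, t, by rw [h]; ring⟩
    · obtain ⟨s, hs⟩ := one_add_two_pow_pow_two_pow n hn j
      obtain ⟨r, rfl⟩ := Nat.exists_eq_add_of_le hn
      refine ⟨k + 2 ^ j, t + s + 1 + 2 ^ (r + 1) * a * (1 + 2 * s)
        + 2 ^ (r + 1 + j) * (2 * t + 1) * (1 + 2 * s), ?_⟩
      rw [pow_add, h, hs]
      ring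

theorem ZMod.exists_one_add_two_pow_pow_eq (m n : ℕ) (hn : 2 ≤ n) (hmn : n ≤ m)
    (a : ZMod (2 ^ m)) : ∃ k : ℕ, (1 + 2 ^ n : ZMod (2 ^ m)) ^ k = 1 + 2 ^ n * a := by
  obtain ⟨a, rfl⟩ := ZMod.intCast_surjective a
  obtain ⟨k, t, h⟩ := exists_one_add_two_pow_pow_eq_add n hn a (m - n)
  refine ⟨k, ?_⟩
  have h0 : (2 : ZMod (2 ^ m)) ^ m = 0 := by exact_mod_cast ZMod.natCast_self (2 ^ m)
  have := congrArg (Int.cast : ℤ → ZMod (2 ^ m)) h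
  rw [Nat.add_sub_cancel' hmn] at this
  push_cast at this
  simpa [h0] using this

theorem ZMod.isUnit_one_add_two_pow (m n : ℕ) (hn : n ≠ 0) :
    IsUnit (1 + 2 ^ n : ZMod (2 ^ m)) := by
  have h : Nat.Coprime (1 + 2 ^ n) (2 ^ m) := by
    refine Nat.Coprime.pow_right _ (Nat.coprime_two_right.mpr ?_)
    exact odd_one.add_even (even_two.pow_of_ne_zero hn)
  exact_mod_cast (ZMod.isUnit_iff_coprime _ _).mpr h

theorem ZMod.exists_eq_two_pow_mul_of_castHom_eq_zero {m n : ℕ} (hmn : n ≤ m) (x : ZMod (2 ^ m))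
    (hx : ZMod.castHom (pow_dvd_pow 2 hmn) (ZMod (2 ^ n)) x = 0) : ∃ t, x = 2 ^ n * t := by
  obtain ⟨x, rfl⟩ := ZMod.natCast_zmod_surjective x
  rw [map_natCast, ZMod.natCast_eq_zero_iff] at hx
  obtain ⟨t, rfl⟩ := hx
  exact ⟨t, by push_cast; rfl⟩

namespace Matrix

variable {R : Type*} [CommRing R]

theorem upper_unipotent_pow (x : R) (k : ℕ) :
    (!![1, x; 0, 1] : Matrix (Fin 2) (Fin 2) R) ^ k = !![1, x * k; 0, 1] := by
  induction k with
  | zero => simp [one_fin_two]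
  | succ k ih => rw [pow_succ, ih]; simp; ring

theorem lower_unipotent_pow (x : R) (k : ℕ) :
    (!![1, 0; x, 1] : Matrix (Fin 2) (Fin 2) R) ^ k = !![1, 0; x * k, 1] := by
  induction k with
  | zero => simp [one_fin_two]
  | succ k ih => rw [pow_succ, ih]; simp; ring

theorem diag_fin_two_pow (x y : R) (k : ℕ) :
    (!![x, 0; 0, y] : Matrix (Fin 2) (Fin 2) R) ^ k = !![x ^ k, 0; 0, y ^ k] := by
  induction k with
  | zero => simp [one_fin_two]
  | succ k ih => rw [pow_succ, ih]; simp [pow_succ]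

/-- The `LDU` decomposition of a `2 × 2` matrix with invertible upper left entry. -/
theorem ldu_fin_two (u b c d v : R) (huv : u * v = 1) :
    !![1, 0; c * v, 1] * !![u, 0; 0, 1] * !![1, 0; 0, d - c * v * b] * !![1, b * v; 0, 1]
      = !![u, b; c, d] := by
  ext i j
  fin_cases i <;> fin_cases j <;> simp <;> grind

end Matrix

/-- Let `m > n ≥ 2` and let `π : GL(2, ℤ/2^mℤ) → GL(2, ℤ/2^nℤ)` be the
natural reduction homomorphism. Then `ker π` equals the subgroup generated by the four
matrices `[[1+2^n, 0],[0, 1]]`, `[[1, 0],[0, 1+2^n]]`, `[[1, 2^n],[0, 1]]`,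
`[[1, 0],[2^n, 1]]` (i.e. by the elements of `GL(2, ℤ/2^mℤ)` whose underlying matrix is
one of these four). -/
theorem stmt_6 (m n : ℕ) (hn : 2 ≤ n) (hmn : n < m) :
    (Matrix.GeneralLinearGroup.map
        (ZMod.castHom (pow_dvd_pow 2 hmn.le) (ZMod (2 ^ n)))).ker =
      Subgroup.closure
        {g : Matrix.GeneralLinearGroup (Fin 2) (ZMod (2 ^ m)) |
          (g : Matrix (Fin 2) (Fin 2) (ZMod (2 ^ m))) = !![1 + 2 ^ n, 0; 0, 1] ∨
          (g : Matrix (Fin 2) (Fin 2) (ZMod (2 ^ m))) = !![1, 0; 0, 1 + 2 ^ n] ∨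
          (g : Matrix (Fin 2) (Fin 2) (ZMod (2 ^ m))) = !![1, 2 ^ n; 0, 1] ∨
          (g : Matrix (Fin 2) (Fin 2) (ZMod (2 ^ m))) = !![1, 0; 2 ^ n, 1]} := by
  set π := ZMod.castHom (pow_dvd_pow 2 hmn.le) (ZMod (2 ^ n)) with hπ
  have hker (g : GeneralLinearGroup (Fin 2) (ZMod (2 ^ m))) :
      g ∈ (GeneralLinearGroup.map π).ker ↔
        (π (g.1 0 0) = 1 ∧ π (g.1 0 1) = 0) ∧ π (g.1 1 0) = 0 ∧ π (g.1 1 1) = 1 := by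
    rw [MonoidHom.mem_ker, Units.ext_iff, ← Matrix.ext_iff]
    simp [Fin.forall_fin_two]
  have h2 : (2 : ZMod (2 ^ n)) ^ n = 0 := by exact_mod_cast ZMod.natCast_self (2 ^ n)
  have hπ2 : π (2 ^ n) = 0 := by rw [map_pow, map_ofNat, h2]
  apply le_antisymm
  · intro g hg
    obtain ⟨⟨h00, h01⟩, h10, h11⟩ := (hker g).mp hg
    have hdvd := ZMod.exists_eq_two_pow_mul_of_castHom_eq_zero hmn.le
    obtain ⟨a, ha⟩ := hdvd (g.1 0 0 - 1) (by rw [← hπ, map_sub, h00, map_one, sub_self])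
    obtain ⟨b, hb⟩ := hdvd _ h01
    obtain ⟨c, hc⟩ := hdvd _ h10
    obtain ⟨d, hd⟩ := hdvd (g.1 1 1 - 1) (by rw [← hπ, map_sub, h11, map_one, sub_self])
    have hunit := ZMod.isUnit_one_add_two_pow m n (by lia)
    obtain ⟨k, hk⟩ := ZMod.exists_one_add_two_pow_pow_eq m n hn hmn.le a
    obtain ⟨v, hv⟩ := (hunit.pow k).exists_right_inv
    obtain ⟨l, hl⟩ := ZMod.exists_one_add_two_pow_pow_eq m n hn hmn.le (d - c * v * (2 ^ n * b))
    obtain ⟨p, hp⟩ := ZMod.natCast_zmod_surjective (c * v)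
    obtain ⟨q, hq⟩ := ZMod.natCast_zmod_surjective (b * v)
    let A := GeneralLinearGroup.mk'' !![(1 + 2 ^ n : ZMod (2 ^ m)), 0; 0, 1] (by simpa using hunit)
    let D := GeneralLinearGroup.mk'' !![1, 0; 0, (1 + 2 ^ n : ZMod (2 ^ m))] (by simpa using hunit)
    let U := GeneralLinearGroup.mk'' !![1, (2 ^ n : ZMod (2 ^ m)); 0, 1] (by simp)
    let L := GeneralLinearGroup.mk'' !![1, 0; (2 ^ n : ZMod (2 ^ m)), 1] (by simp)
    have hg' : g = L ^ p * A ^ k * D ^ l * U ^ q := by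
      apply Units.ext
      change g.1 = !![1, 0; (2 ^ n : ZMod (2 ^ m)), 1] ^ p *
        !![(1 + 2 ^ n : ZMod (2 ^ m)), 0; 0, 1] ^ k *
        !![1, 0; 0, (1 + 2 ^ n : ZMod (2 ^ m))] ^ l * !![1, (2 ^ n : ZMod (2 ^ m)); 0, 1] ^ q
      rw [lower_unipotent_pow, upper_unipotent_pow, diag_fin_two_pow, diag_fin_two_pow, hp, hq,
        one_pow, one_pow, hl, eta_fin_two g.1,
        ← ldu_fin_two (g.1 0 0) (g.1 0 1) (g.1 1 0) (g.1 1 1) v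
          (by rw [← hv, hk, ← ha]; ring), hk, ← ha, hb, hc, eq_add_of_sub_eq hd]
      congr 3 <;> ring_nf
    rw [hg']
    refine mul_mem (mul_mem (mul_mem ?_ ?_) ?_) ?_ <;>
      refine pow_mem (Subgroup.subset_closure ?_) _
    · exact .inr (.inr (.inr rfl))
    · exact .inl rfl
    · exact .inr (.inl rfl)
    · exact .inr (.inr (.inl rfl))
  · rw [Subgroup.closure_le]
    rintro g (h | h | h | h) <;> rw [SetLike.mem_coe, hker, h] <;> simp [hπ2, -map_pow]
end

section
/- Let m ≥ 2 be an integer and let π : GL(2, ℤ/2^mℤ) → GL(2, ℤ/2ℤ) be the natural reduction homomorphism. Then the kernel of π equals the subgroup of GL(2, ℤ/2^mℤ) generated by the six matrices [[3, 0],[0, 1]], [[5, 0],[0, 1]], [[1, 0],[0, 3]], [[1, 0],[0, 5]], [[1, 2],[0, 1]], and [[1, 0],[2, 1]]. -/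
open Matrix Matrix.GeneralLinearGroup in
/-- The map sending `(u, v)` to the diagonal matrix `[u, 0; 0, v]`. -/
@[simps apply]
def diagonalUnitsHom (R : Type*) [CommRing R] : Rˣ × Rˣ →* GL (Fin 2) R where
  toFun u := ⟨!![(u.1 : R), 0; 0, (u.2 : R)], !![(u.1⁻¹ : Rˣ).1, 0; 0, (u.2⁻¹ : Rˣ).1],
    by simp [one_fin_two], by simp [one_fin_two]⟩
  map_one' := by simp [Units.ext_iff, one_fin_two]
  map_mul' u v := by simp [Units.ext_iff]

open Matrix Matrix.GeneralLinearGroup in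
/-- The map sending `x` to `[1, 0; x, 1]`, bundled as an `AddChar`. -/
@[simps apply]
def lowerLeftHom (R : Type*) [CommRing R] : AddChar R (GL (Fin 2) R) where
  toFun x := ⟨!![1, 0; x, 1], !![1, 0; -x, 1], by simp [one_fin_two], by simp [one_fin_two]⟩
  map_zero_eq_one' := by simp [Units.ext_iff, one_fin_two]
  map_add_eq_mul' a b := by simp [Units.ext_iff]

open Matrix Matrix.GeneralLinearGroup in
/-- Factorization of an invertible matrix whose upper left entry is a unit. -/
theorem eq_lowerLeftHom_mul_diagonalUnitsHom_mul_upperRightHom {R : Type*} [CommRing R]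
    (g : GL (Fin 2) R) (u v : Rˣ) (hu : g 0 0 = u)
    (hv : (v : R) = g 1 1 - g 1 0 * (u⁻¹ : Rˣ) * g 0 1) :
    g = lowerLeftHom R (g 1 0 * (u⁻¹ : Rˣ)) * diagonalUnitsHom R (u, v) *
      upperRightHom ((u⁻¹ : Rˣ) * g 0 1) := by
  ext i j
  fin_cases i <;> fin_cases j <;> simp [hu, hv, mul_assoc]

/-- The units of `ℤ/2^(n+2)ℤ` are generated by any two units with values `3` and `5`. -/
theorem ZMod.closure_three_five_eq_top {n : ℕ} {a b : (ZMod (2 ^ (n + 2)))ˣ}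
    (ha : (a : ZMod (2 ^ (n + 2))) = 3) (hb : (b : ZMod (2 ^ (n + 2))) = 5) :
    Subgroup.closure {a, b} = ⊤ := by
  have hle : Subgroup.zpowers b ≤ Subgroup.closure {a, b} := by
    rw [Subgroup.zpowers_le]
    exact Subgroup.subset_closure (by simp)
  have h4 : 4 ∣ 2 ^ (n + 2) := ⟨2 ^ n, by ring⟩
  have hker : Subgroup.zpowers b ≤ (ZMod.unitsMap h4).ker := by
    rw [Subgroup.zpowers_le, MonoidHom.mem_ker, Units.ext_iff, ZMod.unitsMap_def, Units.coe_map,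
      hb]
    simp only [MonoidHom.coe_coe, map_ofNat]
    decide
  have hna : a ∉ Subgroup.zpowers b := fun h ↦ by
    have := hker h
    rw [MonoidHom.mem_ker, Units.ext_iff, ZMod.unitsMap_def, Units.coe_map, ha] at this
    simp only [MonoidHom.coe_coe, map_ofNat] at this
    exact absurd this (by decide)
  have hcard : Nat.card (Subgroup.zpowers b) = 2 ^ n := by
    rw [Nat.card_zpowers, ← orderOf_units, hb, ZMod.orderOf_five]
  have htot : Nat.card (ZMod (2 ^ (n + 2)))ˣ = 2 ^ n * 2 := by
    rw [Nat.card_eq_fintype_card, ZMod.card_units_eq_totient,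
      Nat.totient_prime_pow_succ Nat.prime_two]
    ring
  obtain ⟨k, hk⟩ := Subgroup.card_dvd_of_le hle
  rw [hcard] at hk
  have hk0 : k ≠ 0 := by
    rintro rfl
    exact Nat.card_pos.ne' hk
  have hk1 : k ≠ 1 := by
    rintro rfl
    have heq := Subgroup.eq_of_le_of_card_ge hle (by rw [hk, hcard, mul_one])
    exact hna (heq ▸ Subgroup.subset_closure (by simp))
  apply Subgroup.eq_top_of_le_card
  rw [htot, hk]
  exact Nat.mul_le_mul_left _ (by lia)

theorem ZMod.exists_eq_nsmul_two_of_castHom_eq_zero {n : ℕ} [NeZero n] (h : 2 ∣ n) {x : ZMod n}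
    (hx : ZMod.castHom h (ZMod 2) x = 0) : ∃ k : ℕ, x = k • (2 : ZMod n) := by
  rw [← ZMod.natCast_zmod_val x, map_natCast, ZMod.natCast_eq_zero_iff] at hx
  obtain ⟨k, hk⟩ := hx
  refine ⟨k, ?_⟩
  rw [← ZMod.natCast_zmod_val x, hk]
  simp [mul_comm]

theorem ZMod.isUnit_of_castHom_eq_one {m : ℕ} (h : 2 ∣ 2 ^ m) {x : ZMod (2 ^ m)}
    (hx : ZMod.castHom h (ZMod 2) x = 1) : IsUnit x := by
  rw [← ZMod.natCast_zmod_val x, map_natCast, ZMod.natCast_eq_one_iff_odd] at hx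
  rw [← ZMod.natCast_zmod_val x, ZMod.isUnit_iff_coprime]
  exact hx.coprime_two_right.pow_right m


/-- Let `m ≥ 2` and let `π : GL(2, ℤ/2^mℤ) → GL(2, ℤ/2ℤ)` be the
natural reduction homomorphism. Then `ker π` equals the subgroup generated by the six
matrices `[[3,0],[0,1]]`, `[[5,0],[0,1]]`, `[[1,0],[0,3]]`, `[[1,0],[0,5]]`,
`[[1,2],[0,1]]`, `[[1,0],[2,1]]` (i.e. by the elements of `GL(2, ℤ/2^mℤ)` whose
underlying matrix is one of these six). -/
theorem stmt_11 (m : ℕ) (hm : 2 ≤ m) :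
    (Matrix.GeneralLinearGroup.map (n := Fin 2)
        (ZMod.castHom (dvd_pow_self 2 (by omega : m ≠ 0)) (ZMod 2))).ker =
      Subgroup.closure
        {g : Matrix.GeneralLinearGroup (Fin 2) (ZMod (2 ^ m)) |
          (g : Matrix (Fin 2) (Fin 2) (ZMod (2 ^ m))) = !![3, 0; 0, 1] ∨
          (g : Matrix (Fin 2) (Fin 2) (ZMod (2 ^ m))) = !![5, 0; 0, 1] ∨
          (g : Matrix (Fin 2) (Fin 2) (ZMod (2 ^ m))) = !![1, 0; 0, 3] ∨
          (g : Matrix (Fin 2) (Fin 2) (ZMod (2 ^ m))) = !![1, 0; 0, 5] ∨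
          (g : Matrix (Fin 2) (Fin 2) (ZMod (2 ^ m))) = !![1, 2; 0, 1] ∨
          (g : Matrix (Fin 2) (Fin 2) (ZMod (2 ^ m))) = !![1, 0; 2, 1]} := by
  have h2 : 2 ∣ 2 ^ m := dvd_pow_self 2 (by omega)
  apply le_antisymm
  · intro g hg
    have hentry (i j : Fin 2) :
        ZMod.castHom h2 (ZMod 2) (g i j) = (1 : Matrix (Fin 2) (Fin 2) (ZMod 2)) i j := by
      rw [MonoidHom.mem_ker] at hg
      rw [← Matrix.GeneralLinearGroup.map_apply, hg, Matrix.GeneralLinearGroup.coe_one]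
    have h00 : ZMod.castHom h2 (ZMod 2) (g 0 0) = 1 := hentry 0 0
    have h01 : ZMod.castHom h2 (ZMod 2) (g 0 1) = 0 := hentry 0 1
    have h10 : ZMod.castHom h2 (ZMod 2) (g 1 0) = 0 := hentry 1 0
    have h11 : ZMod.castHom h2 (ZMod 2) (g 1 1) = 1 := hentry 1 1
    obtain ⟨u, hu⟩ := ZMod.isUnit_of_castHom_eq_one h2 h00
    obtain ⟨v, hv⟩ := ZMod.isUnit_of_castHom_eq_one h2
      (x := g 1 1 - g 1 0 * (u⁻¹ : (ZMod (2 ^ m))ˣ) * g 0 1)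
      (by rw [map_sub, map_mul, map_mul, h10, h11, h01, mul_zero, sub_zero])
    obtain ⟨k, hk⟩ := ZMod.exists_eq_nsmul_two_of_castHom_eq_zero h2
      (x := g 1 0 * (u⁻¹ : (ZMod (2 ^ m))ˣ)) (by rw [map_mul, h10, zero_mul])
    obtain ⟨l, hl⟩ := ZMod.exists_eq_nsmul_two_of_castHom_eq_zero h2
      (x := (u⁻¹ : (ZMod (2 ^ m))ˣ) * g 0 1) (by rw [map_mul, h01, mul_zero])
    obtain ⟨a, ha⟩ := ZMod.isUnit_of_castHom_eq_one h2 (x := 3) (by rw [map_ofNat]; decide)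
    obtain ⟨b, hb⟩ := ZMod.isUnit_of_castHom_eq_one h2 (x := 5) (by rw [map_ofNat]; decide)
    have htop : Subgroup.closure {a, b} = ⊤ := by
      obtain ⟨n, rfl⟩ := Nat.exists_eq_add_of_le' hm
      exact ZMod.closure_three_five_eq_top ha hb
    rw [eq_lowerLeftHom_mul_diagonalUnitsHom_mul_upperRightHom g u v hu.symm hv, hk, hl,
      AddChar.map_nsmul_eq_pow, AddChar.map_nsmul_eq_pow,
      show (u, v) = MonoidHom.inl _ _ u * MonoidHom.inr _ _ v by simp, map_mul]
    refine mul_mem (mul_mem (pow_mem (Subgroup.subset_closure (by simp)) k)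
      (mul_mem ?_ ?_)) (pow_mem (Subgroup.subset_closure (by simp)) l)
    · rw [← MonoidHom.comp_apply, ← Subgroup.mem_comap]
      refine (htop.symm.le.trans ((Subgroup.closure_le _).2 ?_)) (Subgroup.mem_top u)
      rintro x (rfl | rfl) <;> exact Subgroup.subset_closure (by simp [ha, hb])
    · rw [← MonoidHom.comp_apply, ← Subgroup.mem_comap]
      refine (htop.symm.le.trans ((Subgroup.closure_le _).2 ?_)) (Subgroup.mem_top v)
      rintro x (rfl | rfl) <;> exact Subgroup.subset_closure (by simp [ha, hb])
  · rw [Subgroup.closure_le]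
    intro g hg
    rw [SetLike.mem_coe, MonoidHom.mem_ker]
    ext i j
    rw [Matrix.GeneralLinearGroup.map_apply]
    rcases hg with hg | hg | hg | hg | hg | hg <;> rw [hg] <;> fin_cases i <;> fin_cases j <;>
      simp [-ZMod.castHom_apply] <;> rw [map_ofNat] <;> decide
end

section
/- Let δ ∈ ℤ₂ be odd, i.e., not divisible by 2. Then there exists a ∈ ℤ₂ such that the square of the 2×2 matrix product [[−1, 0],[1, 1]] · [[a+1, 1],[δ, a]] over ℤ₂ equals the negative of the 2×2 identity matrix. -/
theorem PadicInt.two_dvd_sub_one_of_not_two_dvd {x : ℤ_[2]} (hx : ¬ (2 : ℤ_[2]) ∣ x) :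
    (2 : ℤ_[2]) ∣ x - 1 := by
  obtain ⟨n, hn, h⟩ := PadicInt.exists_mem_range (p := 2) x
  rw [PadicInt.maximalIdeal_eq_span_p, Ideal.mem_span_singleton] at h
  interval_cases n
  · exact absurd (by simpa using h) hx
  · simpa using h

open Polynomial in
/-- The Artin–Schreier type equation `a² + a = c` is solvable in `ℤ₂` for even `c`. -/
theorem PadicInt.exists_sq_add_self_eq {c : ℤ_[2]} (hc : (2 : ℤ_[2]) ∣ c) :
    ∃ a : ℤ_[2], a ^ 2 + a = c := by
  have hnorm : ‖c‖ < 1 := (PadicInt.norm_lt_one_iff_dvd c).2 (by simpa using hc)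
  obtain ⟨a, ha, -⟩ := hensels_lemma (F := (X ^ 2 + X - C c : ℤ_[2][X])) (a := (0 : ℤ_[2]))
    (by simpa using hnorm)
  exact ⟨a, sub_eq_zero.1 (by simpa using ha)⟩


/-- Let `δ ∈ ℤ₂` be odd (not divisible by `2`). Then there exists
`a ∈ ℤ₂` such that `([[-1,0],[1,1]] · [[a+1,1],[δ,a]])² = -Id` as `2×2` matrices
over `ℤ₂`. -/
theorem stmt_15 (δ : ℤ_[2]) (hδ : ¬ (2 : ℤ_[2]) ∣ δ) :
    ∃ a : ℤ_[2],
      (!![-1, 0; 1, 1] * !![a + 1, 1; δ, a]) ^ 2 =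
        -(1 : Matrix (Fin 2) (Fin 2) ℤ_[2]) := by
  obtain ⟨a, ha⟩ := PadicInt.exists_sq_add_self_eq
    (PadicInt.two_dvd_sub_one_of_not_two_dvd hδ)
  refine ⟨a, ?_⟩
  ext i j
  fin_cases i <;> fin_cases j <;> simp [sq, Matrix.mul_apply, Fin.sum_univ_two] <;> grind
end

section
/- (Generalized Hensel's Lemma) Let p be a prime, let f be a polynomial with integer coefficients, and let a be an integer. Let j and τ be nonnegative integers with j ≥ 2τ + 1. Suppose f(a) ≡ 0 (mod p^j) and that p^τ exactly divides f'(a), i.e., p^τ ∣ f'(a) and p^(τ+1) ∤ f'(a). Then there exists an integer t, unique modulo p, such that f(a + t·p^(j−τ)) ≡ 0 (mod p^(j+1)). -/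
/-- **Generalized Hensel's Lemma.** Let `p` be a prime, `f ∈ ℤ[X]`,
`a ∈ ℤ`, and let `j, τ` be nonnegative integers with `j ≥ 2τ + 1`. Suppose
`f(a) ≡ 0 (mod p^j)` and `p^τ` exactly divides `f'(a)`. Then there is an integer `t`,
unique modulo `p`, such that `f(a + t·p^(j-τ)) ≡ 0 (mod p^(j+1))`. -/
theorem stmt_19 (p : ℕ) (hp : p.Prime) (f : Polynomial ℤ) (a : ℤ) (j τ : ℕ)
    (hj : 2 * τ + 1 ≤ j)
    (hfa : (p : ℤ) ^ j ∣ f.eval a)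
    (hdvd : (p : ℤ) ^ τ ∣ (Polynomial.derivative f).eval a)
    (hndvd : ¬ (p : ℤ) ^ (τ + 1) ∣ (Polynomial.derivative f).eval a) :
    ∃ t : ℤ,
      ((p : ℤ) ^ (j + 1) ∣ f.eval (a + t * (p : ℤ) ^ (j - τ))) ∧
      ∀ t' : ℤ, ((p : ℤ) ^ (j + 1) ∣ f.eval (a + t' * (p : ℤ) ^ (j - τ))) →
        t' ≡ t [ZMOD (p : ℤ)] := by
  obtain ⟨i, rfl⟩ := Nat.exists_eq_add_of_le hj
  obtain ⟨c, hc⟩ := hfa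
  obtain ⟨u, hu⟩ := hdvd
  have hp0 : (p : ℤ) ≠ 0 := by exact_mod_cast hp.ne_zero
  have hpu : ¬ (p : ℤ) ∣ u := fun h => hndvd <| by
    rw [hu, pow_succ]
    exact mul_dvd_mul_left _ h
  have hcop : IsCoprime (p : ℤ) u :=
    (Nat.prime_iff_prime_int.mp hp).irreducible.coprime_iff_not_dvd.mpr hpu
  have hm : 2 * τ + 1 + i - τ = τ + 1 + i := by omega
  have key (t : ℤ) : (p : ℤ) ^ (2 * τ + 1 + i + 1) ∣
      f.eval (a + t * (p : ℤ) ^ (2 * τ + 1 + i - τ)) ↔ (p : ℤ) ∣ c + u * t := by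
    obtain ⟨k, hk⟩ := f.binomExpansion a (t * (p : ℤ) ^ (τ + 1 + i))
    have hexp : f.eval (a + t * (p : ℤ) ^ (τ + 1 + i)) =
        (p : ℤ) ^ (2 * τ + 1 + i) * (c + u * t + p * (k * t ^ 2 * (p : ℤ) ^ i)) := by
      rw [hk, hc, hu]
      ring
    rw [hm, hexp, pow_succ, mul_dvd_mul_iff_left (pow_ne_zero _ hp0),
      dvd_add_left (dvd_mul_right _ _)]
  simp only [key]
  obtain ⟨x, y, hxy⟩ := id hcop
  have hroot : (p : ℤ) ∣ c + u * (-c * y) := ⟨c * x, by linear_combination -c * hxy⟩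
  refine ⟨-c * y, hroot, fun t' ht' => (Int.modEq_iff_dvd.mpr ?_).symm⟩
  refine hcop.dvd_of_dvd_mul_left ?_
  convert dvd_sub ht' hroot using 1
  ring
end
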